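/- Assume M ≥ N ≥ 3, equi-divisible congestion, μ₁ < 6μ_{N−1}, and μ_N ≤ μ₁/2. Consider the two-block partition P = {C, {1}} with C = {2,…,N}. Then the strategy profile φ in which player 1 chooses link a₁ and the members of C choose the links a₁, a₂, …, a_{N−1} (one member per link, so that only link a₁ is used twice) is a Nash equilibrium for P. -/

import Mathlib

open Finset

namespace CG

variable {N M : ℕ}

/-- Number of players choosing link `a` under profile `φ`. -/
def gamma (φ : Fin N → Fin M) (a : Fin M) : ℕ :=
  (Finset.univ.filter fun i => φ i = a).card

/-- Utility of coalition `C` under profile `φ` at per-communication cost `β`. -/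
noncomputable def util (μ : Fin M → ℕ → ℝ) (β : ℝ) (C : Finset (Fin N))
    (φ : Fin N → Fin M) : ℝ :=
  (∑ i ∈ C, μ (φ i) (gamma φ (φ i))) - ((C.card : ℝ) - 1) * β

/-- `P` is a partition of the player set into (nonempty, pairwise disjoint) coalitions. -/
def IsPartition (P : Finset (Finset (Fin N))) : Prop :=
  (∀ C ∈ P, C.Nonempty) ∧
  (∀ C ∈ P, ∀ C' ∈ P, C ≠ C' → Disjoint C C') ∧
  (∀ i : Fin N, ∃ C ∈ P, i ∈ C)

/-- `φ` is a Nash equilibrium for partition `P`: no coalition of `P` can strictly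
improve its utility by unilaterally changing the strategies of its own members. -/
def IsNE (μ : Fin M → ℕ → ℝ) (β : ℝ) (P : Finset (Finset (Fin N)))
    (φ : Fin N → Fin M) : Prop :=
  ∀ C ∈ P, ∀ φ' : Fin N → Fin M, (∀ i ∉ C, φ' i = φ i) →
    util μ β C φ' ≤ util μ β C φ

/-- Pessimal anticipated worth of a coalition `C`. -/
noncomputable def pess (μ : Fin M → ℕ → ℝ) (β : ℝ) (C : Finset (Fin N)) : ℝ :=
  sInf {x : ℝ | ∃ P' : Finset (Finset (Fin N)), ∃ φ' : Fin N → Fin M,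
    IsPartition P' ∧ C ∈ P' ∧ IsNE μ β P' φ' ∧ x = util μ β C φ'}

/-- `ψ` is a payoff vector consistent with `(P, φ)`. -/
def Consistent (μ : Fin M → ℕ → ℝ) (β : ℝ) (P : Finset (Finset (Fin N)))
    (φ : Fin N → Fin M) (ψ : Fin N → ℝ) : Prop :=
  (∀ j, 0 ≤ ψ j) ∧ ∀ C ∈ P, ∑ j ∈ C, ψ j = util μ β C φ

/-- Coalition `C ∉ P` blocks the configuration with payoff vector `ψ`. -/
def Blocks (μ : Fin M → ℕ → ℝ) (β : ℝ) (P : Finset (Finset (Fin N)))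
    (ψ : Fin N → ℝ) (C : Finset (Fin N)) : Prop :=
  C.Nonempty ∧ C ∉ P ∧ ∑ j ∈ C, ψ j < pess μ β C

/-- The configuration `(P, φ, ψ)` is stable. -/
def ConfigStable (μ : Fin M → ℕ → ℝ) (β : ℝ) (P : Finset (Finset (Fin N)))
    (φ : Fin N → Fin M) (ψ : Fin N → ℝ) : Prop :=
  IsPartition P ∧ IsNE μ β P φ ∧ Consistent μ β P φ ψ ∧
    ∀ C : Finset (Fin N), ¬ Blocks μ β P ψ C

/-- The P-NE pair `(P, φ)` is stable. -/
def PairStable (μ : Fin M → ℕ → ℝ) (β : ℝ) (P : Finset (Finset (Fin N)))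
    (φ : Fin N → Fin M) : Prop :=
  ∃ ψ : Fin N → ℝ, ConfigStable μ β P φ ψ

/-- The partition `P` is stable. -/
def PartStable (μ : Fin M → ℕ → ℝ) (β : ℝ) (P : Finset (Finset (Fin N))) : Prop :=
  ∃ φ : Fin N → Fin M, PairStable μ β P φ

/-- The ALC partition, in which every player is a singleton coalition. -/
def ALC (N : ℕ) : Finset (Finset (Fin N)) :=
  Finset.univ.image fun i => ({i} : Finset (Fin N))

/-- `D_C^P = Σ_i q_i(C)/l_i − 1`. -/
noncomputable def Dcoef (P : Finset (Finset (Fin N))) (C : Finset (Fin N)) : ℝ :=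
  (∑ Ci ∈ P, ((Ci ∩ C).card : ℝ) / (Ci.card : ℝ)) - 1

/-- `Γ_C^P(φ) = Σ_i (q_i(C)/l_i) ν_{C_i}^{0,P}(φ) − ν̲_C^0`. -/
noncomputable def Gam (μ : Fin M → ℕ → ℝ) (P : Finset (Finset (Fin N)))
    (φ : Fin N → Fin M) (C : Finset (Fin N)) : ℝ :=
  (∑ Ci ∈ P, ((Ci ∩ C).card : ℝ) / (Ci.card : ℝ) * util μ 0 Ci φ) - pess μ 0 C

/-- `B^{--}`. -/
def Bmm (μ : Fin M → ℕ → ℝ) (P : Finset (Finset (Fin N))) (φ : Fin N → Fin M) :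
    Set (Finset (Fin N)) :=
  {C | (C.Nonempty ∧ C ∉ P) ∧ Dcoef P C ≤ 0 ∧ Gam μ P φ C < 0}

/-- `B^{+-}`. -/
def Bpm (μ : Fin M → ℕ → ℝ) (P : Finset (Finset (Fin N))) (φ : Fin N → Fin M) :
    Set (Finset (Fin N)) :=
  {C | (C.Nonempty ∧ C ∉ P) ∧ 0 < Dcoef P C ∧ Gam μ P φ C < 0}

/-- `B^{-+}`. -/
def Bmp (μ : Fin M → ℕ → ℝ) (P : Finset (Finset (Fin N))) (φ : Fin N → Fin M) :
    Set (Finset (Fin N)) :=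
  {C | (C.Nonempty ∧ C ∉ P) ∧ Dcoef P C < 0 ∧ 0 ≤ Gam μ P φ C}

/-- `β̄_u^P(φ) = min_{C ∈ B^{-+}} (−Γ_C^P(φ)/D_C^P)`, with `min ∅ = +∞` (in `EReal`). -/
noncomputable def betaU (μ : Fin M → ℕ → ℝ) (P : Finset (Finset (Fin N)))
    (φ : Fin N → Fin M) : EReal :=
  sInf ((fun C => ((-(Gam μ P φ C) / Dcoef P C : ℝ) : EReal)) '' Bmp μ P φ)

/-- `β̄_d^P(φ) = max_{C ∈ B^{+-}} (−Γ_C^P(φ)/D_C^P)`, with `max ∅ = 0` (in `EReal`). -/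
noncomputable def betaD (μ : Fin M → ℕ → ℝ) (P : Finset (Finset (Fin N)))
    (φ : Fin N → Fin M) : EReal :=
  sSup (insert (0 : EReal)
    ((fun C => ((-(Gam μ P φ C) / Dcoef P C : ℝ) : EReal)) '' Bpm μ P φ))

end CG
/-- Exchange bound: if `w` separates the values on `S \ T` from those on `T \ S`, then
replacing `T` by `S` changes the sum by at most `(#S - #T) * w`. -/
lemma Finset.sum_le_sum_add_card_sub_mul {α : Type*} [DecidableEq α] (S T : Finset α) (v : α → ℝ)
    (w : ℝ) (hS : ∀ a ∈ S \ T, v a ≤ w) (hT : ∀ a ∈ T \ S, w ≤ v a) :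
    ∑ a ∈ S, v a ≤ ∑ a ∈ T, v a + ((S.card : ℝ) - T.card) * w := by
  have h1 := Finset.sum_le_card_nsmul _ _ _ hS
  have h2 := Finset.card_nsmul_le_sum _ _ _ hT
  rw [nsmul_eq_mul] at h1 h2
  have h3 := Finset.sum_inter_add_sum_sdiff S T v
  have h4 := Finset.sum_inter_add_sum_sdiff T S v
  have h5 : ((S ∩ T).card : ℝ) + (S \ T).card = S.card := by
    exact_mod_cast Finset.card_inter_add_card_sdiff S T
  have h6 : ((T ∩ S).card : ℝ) + (T \ S).card = T.card := by
    exact_mod_cast Finset.card_inter_add_card_sdiff T S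
  rw [Finset.inter_comm T S] at h4 h6
  have h7 : ((S.card : ℝ) - T.card) * w = (S \ T).card * w - (T \ S).card * w := by
    rw [← h5, ← h6]; ring
  linarith

/-- Under equal division, players in `D` collect at most the full value of each link they use. -/
lemma CG.sum_div_gamma_le {N M : ℕ} (v : Fin M → ℝ) (hv : ∀ a, 0 ≤ v a) (φ : Fin N → Fin M)
    (D : Finset (Fin N)) :
    ∑ i ∈ D, v (φ i) / CG.gamma φ (φ i) ≤ ∑ a ∈ D.image φ, v a := by
  rw [Finset.sum_comp (fun a => v a / (CG.gamma φ a : ℝ)) φ]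
  refine Finset.sum_le_sum fun a _ => ?_
  have hc : ((D.filter fun i => φ i = a).card : ℝ) ≤ CG.gamma φ a := by
    exact_mod_cast Finset.card_le_card (Finset.filter_subset_filter _ (Finset.subset_univ D))
  rw [nsmul_eq_mul, mul_div_left_comm]
  exact mul_le_of_le_one_right (hv a) (div_le_one_of_le₀ hc (Nat.cast_nonneg _))

/-- The share of a contested link gained by sending `k ≥ 1` members there instead of one costs
at most what is lost on the `k - 1` vacated links. -/
lemma share_le_half_add {x w : ℝ} (hx : 0 ≤ x) (h : x < 6 * w) {k : ℕ} (hk : 1 ≤ k) :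
    k * (x / (k + 1)) ≤ x / 2 + (k - 1) * w := by
  have hk' : (1 : ℝ) ≤ k := by exact_mod_cast hk
  have key : (k : ℝ) * (x / (k + 1)) = x / 2 + (k - 1) * (x / (2 * (k + 1))) := by
    field_simp
    ring
  rw [key]
  rcases hk.eq_or_lt with rfl | h2
  · simp
  · have h2' : (2 : ℝ) ≤ k := by exact_mod_cast h2
    have : x / (2 * (k + 1)) ≤ w := by
      rw [div_le_iff₀ (by positivity)]
      nlinarith
    nlinarith

open CG in
/-- with equi-divisible congestion, `μ₁ < 6 μ_{N−1}` and
`μ_N ≤ μ₁/2`, the profile where player `0` (the singleton) takes link `a₁` and the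
coalition `{1,…,N−1}` takes links `a₁, …, a_{N−1}` (player `j ↦ a_j`, so only `a₁`
is used twice) is a Nash equilibrium for the partition `{C, {0}}`. -/
theorem stmt17 {N M : ℕ} (hN : 3 ≤ N) (hMN : N ≤ M)
    (μ : Fin M → ℕ → ℝ)
    (hpos : ∀ a : Fin M, ∀ k : ℕ, 1 ≤ k → k ≤ N → 0 < μ a k)
    (hmono : ∀ a b : Fin M, a ≤ b → μ b 1 ≤ μ a 1)
    (hequi : ∀ a : Fin M, ∀ k : ℕ, 1 ≤ k → μ a k = μ a 1 / k)
    (h6 : μ (Fin.castLE hMN ⟨0, by omega⟩) 1 <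
      6 * μ (Fin.castLE hMN ⟨N - 2, by omega⟩) 1)
    (hhalf : μ (Fin.castLE hMN ⟨N - 1, by omega⟩) 1 ≤
      μ (Fin.castLE hMN ⟨0, by omega⟩) 1 / 2) :
    IsNE μ 0
      ({Finset.univ.erase (⟨0, by omega⟩ : Fin N), {(⟨0, by omega⟩ : Fin N)}} :
        Finset (Finset (Fin N)))
      (fun i => (⟨(i : ℕ) - 1,
        lt_of_le_of_lt (Nat.sub_le _ _) (lt_of_lt_of_le i.2 hMN)⟩ : Fin M)) := by
  set p : Fin N := ⟨0, by omega⟩ with hp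
  set q : Fin N := ⟨1, by omega⟩ with hq
  set z : Fin M := Fin.castLE hMN ⟨0, by omega⟩ with hz
  set y : Fin M := Fin.castLE hMN ⟨N - 2, by omega⟩ with hy
  set x : Fin M := Fin.castLE hMN ⟨N - 1, by omega⟩ with hx
  set φ : Fin N → Fin M := fun i => (⟨(i : ℕ) - 1,
        lt_of_le_of_lt (Nat.sub_le _ _) (lt_of_lt_of_le i.2 hMN)⟩ : Fin M) with hφ
  have hv : ∀ a, 0 ≤ μ a 1 := fun a => (hpos a 1 le_rfl (by omega)).le
  have hγpos : ∀ (ψ : Fin N → Fin M) (i : Fin N), 1 ≤ gamma ψ (ψ i) := fun ψ i =>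
    Finset.card_pos.2 ⟨i, by simp⟩
  have hutil : ∀ (C : Finset (Fin N)) (ψ : Fin N → Fin M),
      util μ 0 C ψ = ∑ i ∈ C, μ (ψ i) 1 / gamma ψ (ψ i) := fun C ψ => by
    simp only [util, mul_zero, sub_zero]
    exact Finset.sum_congr rfl fun i _ => hequi _ _ (hγpos ψ i)
  have hφp : φ p = z := rfl
  have hφq : φ q = z := rfl
  have hpq : p ≠ q := by simp [hp, hq]
  have hγz : gamma φ z = 2 := by
    rw [gamma, Finset.card_eq_two]
    refine ⟨p, q, hpq, ?_⟩
    ext i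
    simp only [Finset.mem_filter, Finset.mem_univ, true_and, Finset.mem_insert,
      Finset.mem_singleton, Fin.ext_iff, hφ, hz, hp, hq, Fin.val_castLE]
    omega
  intro C hC φ' hφ'
  rw [Finset.mem_insert, Finset.mem_singleton] at hC
  rw [hutil, hutil]
  rcases hC with rfl | rfl
  · have hp' : φ' p = z := by rw [hφ' p (by simp), hφp]
    set E : Finset (Fin N) := (Finset.univ.erase p).erase q with hE
    have hEcard : E.card = N - 2 := by
      rw [hE, Finset.card_erase_of_mem (by simp [hpq.symm]), Finset.card_erase_of_mem (by simp)]
      simp only [Finset.card_univ, Fintype.card_fin]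
      omega
    have hEmem : ∀ i, i ∈ E ↔ 2 ≤ (i : ℕ) := fun i => by
      simp only [hE, Finset.mem_erase, Finset.mem_univ, Fin.ext_iff, hp, hq, ne_eq, and_true]
      omega
    have hinj : Set.InjOn φ E := fun i hi j hj hij => by
      have hi' := (hEmem i).1 hi
      have hj' := (hEmem j).1 hj
      simp only [hφ, Fin.ext_iff] at hij
      exact Fin.ext (by omega)
    set T := E.image φ with hT
    have hTcard : T.card = N - 2 := by rw [hT, Finset.card_image_of_injOn hinj, hEcard]
    have hTmem : ∀ a : Fin M, a ∈ T ↔ 1 ≤ (a : ℕ) ∧ (a : ℕ) ≤ N - 2 := fun a => by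
      rw [hT, Finset.mem_image]
      constructor
      · rintro ⟨i, hi, rfl⟩
        have hi' := (hEmem i).1 hi
        have := i.2
        simp only [hφ]
        omega
      · rintro ⟨h1, h2⟩
        refine ⟨⟨a + 1, by omega⟩, (hEmem _).2 (by simp only; omega), Fin.ext ?_⟩
        simp [hφ]
    have hbase : ∑ i ∈ Finset.univ.erase p, μ (φ i) 1 / gamma φ (φ i) =
        μ z 1 / 2 + ∑ a ∈ T, μ a 1 := by
      rw [← Finset.add_sum_erase _ _ (show q ∈ Finset.univ.erase p by simp [hpq.symm]), hφq, hγz,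
        hT, Finset.sum_image hinj]
      congr 1
      refine Finset.sum_congr rfl fun i hi => ?_
      have hi' := (hEmem i).1 hi
      have : gamma φ (φ i) = 1 := by
        rw [gamma, Finset.card_eq_one]
        refine ⟨i, ?_⟩
        ext j
        simp only [Finset.mem_filter, Finset.mem_univ, true_and, Finset.mem_singleton,
          Fin.ext_iff, hφ]
        omega
      simp [this]
    rw [hbase]
    set K := (Finset.univ.erase p).filter fun i => φ' i = z with hK
    set D := (Finset.univ.erase p).filter fun i => ¬ φ' i = z with hD
    have hKD : K.card + D.card = N - 1 := by
      rw [hK, hD, Finset.card_filter_add_card_filter_not,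
        Finset.card_erase_of_mem (Finset.mem_univ _)]
      simp
    rw [← Finset.sum_filter_add_sum_filter_not _ (fun i => φ' i = z), ← hK, ← hD]
    have hγK : K.card + 1 ≤ gamma φ' z := by
      rw [← Finset.card_insert_of_notMem (show p ∉ K by simp [hK])]
      refine Finset.card_le_card fun i hi => ?_
      rcases Finset.mem_insert.1 hi with rfl | hi
      · simpa using hp'
      · simpa using (Finset.mem_filter.1 hi).2
    have hKsum : ∑ i ∈ K, μ (φ' i) 1 / gamma φ' (φ' i) ≤
        K.card * (μ z 1 / ((K.card : ℝ) + 1)) := by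
      rw [← nsmul_eq_mul]
      refine Finset.sum_le_card_nsmul _ _ _ fun i hi => ?_
      rw [(Finset.mem_filter.1 hi).2]
      refine div_le_div_of_nonneg_left (hv z) (by positivity) ?_
      exact_mod_cast hγK
    have hDsum := sum_div_gamma_le (fun a => μ a 1) hv φ' D
    set S := D.image φ' with hS
    have hScard : S.card ≤ D.card := Finset.card_image_le
    have hSmem : ∀ a ∈ S, 1 ≤ (a : ℕ) := fun a ha => by
      obtain ⟨i, hi, rfl⟩ := Finset.mem_image.1 ha
      have h := (Finset.mem_filter.1 hi).2
      rw [Fin.ext_iff] at h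
      simp only [hz, Fin.val_castLE] at h
      omega
    have hout : ∀ a ∈ S \ T, μ a 1 ≤ μ x 1 := fun a ha => by
      rw [Finset.mem_sdiff, hTmem] at ha
      have := hSmem a ha.1
      refine hmono _ _ (Fin.le_def.2 ?_)
      simp only [hx, Fin.val_castLE]
      omega
    have hin : ∀ a ∈ T \ S, μ y 1 ≤ μ a 1 := fun a ha => by
      rw [Finset.mem_sdiff, hTmem] at ha
      refine hmono _ _ (Fin.le_def.2 ?_)
      simp only [hy, Fin.val_castLE]
      omega
    have hxy : μ x 1 ≤ μ y 1 := by
      refine hmono _ _ (Fin.le_def.2 ?_)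
      simp only [hx, hy, Fin.val_castLE]
      omega
    have hcard : (S.card : ℝ) - T.card ≤ 1 - K.card := by
      have : S.card + K.card ≤ T.card + 1 := by omega
      have : (S.card : ℝ) + K.card ≤ T.card + 1 := by exact_mod_cast this
      linarith
    rcases Nat.eq_zero_or_pos K.card with h0 | h1
    · have hex := Finset.sum_le_sum_add_card_sub_mul S T (fun a => μ a 1) (μ x 1) hout
        fun a ha => hxy.trans (hin a ha)
      have := mul_le_mul_of_nonneg_right hcard (hv x)
      rw [h0] at hKsum this
      simp only [Nat.cast_zero, zero_mul, sub_zero, one_mul] at hKsum this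
      linarith
    · have hex := Finset.sum_le_sum_add_card_sub_mul S T (fun a => μ a 1) (μ y 1)
        (fun a ha => (hout a ha).trans hxy) hin
      have := mul_le_mul_of_nonneg_right hcard (hv y)
      have := share_le_half_add (hv z) h6 h1
      linarith
  · rw [Finset.sum_singleton, Finset.sum_singleton, hφp, hγz]
    by_cases hb : (φ' p : ℕ) ≤ N - 2
    · have h2 : 2 ≤ gamma φ' (φ' p) := by
        have hne : p ≠ ⟨φ' p + 1, by omega⟩ := by simp [hp, Fin.ext_iff]
        rw [← Finset.card_pair hne]
        refine Finset.card_le_card fun i hi => ?_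
        rcases Finset.mem_insert.1 hi with rfl | hi
        · simp
        · rw [Finset.mem_singleton] at hi
          have h := hφ' i (by simp [hi, hp])
          rw [Finset.mem_filter, h]
          exact ⟨Finset.mem_univ _, Fin.ext (by simp [hφ, hi])⟩
      refine div_le_div₀ (hv z) (hmono _ _ (Fin.le_def.2 (Nat.zero_le _))) (by norm_num) ?_
      exact_mod_cast h2
    · have h1 : (1 : ℝ) ≤ gamma φ' (φ' p) := by exact_mod_cast hγpos φ' p
      have hle : μ (φ' p) 1 ≤ μ x 1 := by
        refine hmono _ _ (Fin.le_def.2 ?_)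
        simp only [hx, Fin.val_castLE]
        omega
      have := div_le_self (hv (φ' p)) h1
      push_cast
      linarith
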